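/- De Moivre–Laplace convergence of the normalized random walk: for each m ≥ 1 let B_m be binomially distributed with parameters m and 1/2, and let μ_m be the law of (2·B_m − m)/√m on ℝ. Then μ_m converges weakly, as m → ∞, to the standard Gaussian measure N(0,1). Equivalently, the normalized random walk X_m = (1/√m) Σ_{k=1}^m Z_k, with Z_k i.i.d. uniform on {−1, +1} (whose law equals μ_m), converges in distribution to N(0,1). -/

import Mathlib

open MeasureTheory ProbabilityTheory Filter
open scoped ENNReal

/-- The law of the normalized random walk `(2·B_m − m)/√m`, where
`B_m ~ Bin(m, 1/2)`: the pushforward of the binomial distribution under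
`b ↦ (2b − m)/√m`. -/
noncomputable def normalizedRandomWalkLaw (m : ℕ) : Measure ℝ :=
  ∑ b ∈ Finset.range (m + 1),
    ((m.choose b : ℝ≥0∞) / 2 ^ m) •
      Measure.dirac ((2 * (b : ℝ) - (m : ℝ)) / Real.sqrt m)

lemma integral_normalizedRandomWalkLaw {E : Type*} [NormedAddCommGroup E] [NormedSpace ℝ E]
    [CompleteSpace E] (f : ℝ → E) (m : ℕ) :
    ∫ x, f x ∂(normalizedRandomWalkLaw m) =
      ∑ b ∈ Finset.range (m + 1),
        ((m.choose b : ℝ) / 2 ^ m) • f ((2 * (b : ℝ) - (m : ℝ)) / Real.sqrt m) := by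
  rw [normalizedRandomWalkLaw, integral_finsetSum_measure]
  · simp [integral_smul_measure]
  · intro b _
    refine (integrable_dirac (by simp)).smul_measure ?_
    exact ENNReal.div_ne_top (by simp) (by simp)

instance isProbabilityMeasure_normalizedRandomWalkLaw (m : ℕ) :
    IsProbabilityMeasure (normalizedRandomWalkLaw m) := by
  constructor
  simp only [normalizedRandomWalkLaw, Measure.coe_finsetSum, Finset.sum_apply,
    Measure.smul_apply, measure_univ, smul_eq_mul, mul_one, div_eq_mul_inv]
  rw [← Finset.sum_mul, ← Nat.cast_sum, Nat.sum_range_choose]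
  push_cast
  exact ENNReal.mul_inv_cancel (by simp) (by simp)

lemma charFun_normalizedRandomWalkLaw (m : ℕ) (t : ℝ) :
    charFun (normalizedRandomWalkLaw m) t = Complex.cos (((Real.sqrt m)⁻¹ * t : ℝ) : ℂ) ^ m := by
  rw [charFun_apply_real, integral_normalizedRandomWalkLaw, Complex.cos, div_pow, add_pow,
    Finset.sum_div]
  refine Finset.sum_congr rfl fun b hb ↦ ?_
  have hbm : b ≤ m := Nat.lt_succ_iff.mp (Finset.mem_range.mp hb)
  rw [← Complex.exp_nat_mul, ← Complex.exp_nat_mul, ← Complex.exp_add, Complex.real_smul,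
    Nat.cast_sub hbm]
  push_cast
  rw [mul_comm (Complex.exp _), ← mul_div_right_comm]
  congr 3
  ring

/-- The law of a fair `±1`-valued coin flip. -/
noncomputable def rademacherLaw : Measure ℝ :=
  (2⁻¹ : ℝ≥0∞) • Measure.dirac 1 + (2⁻¹ : ℝ≥0∞) • Measure.dirac (-1)

instance isProbabilityMeasure_rademacherLaw : IsProbabilityMeasure rademacherLaw :=
  ⟨by simp [rademacherLaw, ENNReal.inv_two_add_inv_two]⟩

lemma integral_rademacherLaw {E : Type*} [NormedAddCommGroup E] [NormedSpace ℝ E]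
    [CompleteSpace E] (f : ℝ → E) :
    ∫ x, f x ∂rademacherLaw = (2⁻¹ : ℝ) • f 1 + (2⁻¹ : ℝ) • f (-1) := by
  rw [rademacherLaw, integral_add_measure]
  · simp [integral_smul_measure]
  all_goals exact (integrable_dirac (by simp)).smul_measure (by simp)

lemma charFun_rademacherLaw (t : ℝ) : charFun rademacherLaw t = Complex.cos t := by
  rw [charFun_apply_real, integral_rademacherLaw, Complex.cos]
  simp only [Complex.real_smul]
  push_cast
  ring_nf

/-- de Moivre–Laplace: the law of the normalized random walk
`(2·B_m − m)/√m` with `B_m ~ Bin(m, 1/2)` converges weakly to the standard Gaussian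
`N(0,1)` as `m → ∞`. -/
theorem normalizedRandomWalk_tendsto_gaussian :
    ∀ f : BoundedContinuousFunction ℝ ℝ,
      Tendsto (fun m => ∫ x, f x ∂(normalizedRandomWalkLaw m)) atTop
        (nhds (∫ x, f x ∂(gaussianReal 0 1))) := by
  intro f
  have hlim : Tendsto (β := ProbabilityMeasure ℝ)
      (fun m ↦ ⟨normalizedRandomWalkLaw m, inferInstance⟩) atTop
      (nhds ⟨gaussianReal 0 1, inferInstance⟩) := by
    refine ProbabilityMeasure.tendsto_of_tendsto_charFun fun t ↦ ?_
    have h := tendsto_charFun_inv_sqrt_mul_pow (P := rademacherLaw) (X := id) aemeasurable_id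
      (by simp [integral_rademacherLaw]) (by simp [integral_rademacherLaw]; norm_num) t
    simpa [charFun_normalizedRandomWalkLaw, charFun_rademacherLaw, charFun_gaussianReal,
      neg_div] using h
  exact ProbabilityMeasure.tendsto_iff_forall_integral_tendsto.mp hlim f
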